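/- For every n ≥ 1 and every n×n matrix A with real entries, the limit lim_{k→∞} (1/k)·‖A^⊗k‖ exists and equals the max-plus spectral radius ρ(A) = max_{1≤p≤n} (1/p)·tr(A^⊗p), where ‖A^⊗k‖ is the maximum entry of the k-fold max-plus power of A. -/

import Mathlib

open Filter

/-- Max-plus product of two real `n×n` matrices: `(A ⊗ B) i j = max_k (A i k + B k j)`. -/
noncomputable def mpMul {n : ℕ} (A B : Fin n → Fin n → ℝ) : Fin n → Fin n → ℝ :=
  fun i j => ⨆ k : Fin n, (A i k + B k j)

/-- `p`-fold max-plus power of a real matrix, with `A^⊗1 = A`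
(the value at `p = 0` is junk and is never used below). -/
noncomputable def mpPow {n : ℕ} (A : Fin n → Fin n → ℝ) : ℕ → Fin n → Fin n → ℝ
  | 0 => A
  | 1 => A
  | p + 2 => mpMul (mpPow A (p + 1)) A

/-- Norm of a real matrix: its maximum entry. -/
noncomputable def mpNorm {n : ℕ} (A : Fin n → Fin n → ℝ) : ℝ :=
  ⨆ i : Fin n, ⨆ j : Fin n, A i j

/-- Max-plus trace of a real matrix: its maximum diagonal entry. -/
noncomputable def mpTr {n : ℕ} (A : Fin n → Fin n → ℝ) : ℝ :=
  ⨆ i : Fin n, A i i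

/-- Max-plus spectral radius: `ρ(A) = max_{1 ≤ p ≤ n} (1/p)·tr(A^⊗p)`. -/
noncomputable def mpRho {n : ℕ} (A : Fin n → Fin n → ℝ) : ℝ :=
  ⨆ p : Fin n, (((p : ℕ) + 1 : ℝ))⁻¹ * mpTr (mpPow A ((p : ℕ) + 1))

theorem add_le_mpMul {n : ℕ} (A B : Fin n → Fin n → ℝ) (i k j : Fin n) :
    A i k + B k j ≤ mpMul A B i j :=
  le_ciSup (f := fun k => A i k + B k j) (Set.finite_range _).bddAbove k

theorem exists_mpMul_eq {n : ℕ} [Nonempty (Fin n)] (A B : Fin n → Fin n → ℝ) (i j : Fin n) :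
    ∃ k, A i k + B k j = mpMul A B i j :=
  exists_eq_ciSup_of_finite (f := fun k => A i k + B k j)

theorem mpPow_succ {n : ℕ} (A : Fin n → Fin n → ℝ) {p : ℕ} (hp : 1 ≤ p) :
    mpPow A (p + 1) = mpMul (mpPow A p) A := by
  obtain ⟨q, rfl⟩ := Nat.exists_eq_add_of_le' hp
  rfl

theorem mpPow_one {n : ℕ} (A : Fin n → Fin n → ℝ) : mpPow A 1 = A := rfl

theorem mpPow_add_le {n : ℕ} [Nonempty (Fin n)] (A : Fin n → Fin n → ℝ) {a b : ℕ}
    (ha : 1 ≤ a) (hb : 1 ≤ b) (i l j : Fin n) :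
    mpPow A a i l + mpPow A b l j ≤ mpPow A (a + b) i j := by
  induction b, hb using Nat.le_induction generalizing j with
  | base =>
    rw [mpPow_succ A ha, mpPow_one]
    exact add_le_mpMul _ _ _ _ _
  | succ b hb ih =>
    obtain ⟨m, hm⟩ := exists_mpMul_eq (mpPow A b) A l j
    rw [mpPow_succ A hb, ← hm, ← add_assoc a b 1, mpPow_succ A (by lia : 1 ≤ a + b)]
    linarith [add_le_mpMul (mpPow A (a + b)) A i m j, ih m]

theorem le_mpNorm {n : ℕ} (A : Fin n → Fin n → ℝ) (i j : Fin n) : A i j ≤ mpNorm A :=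
  (le_ciSup (f := fun j => A i j) (Set.finite_range _).bddAbove j).trans
    (le_ciSup (f := fun i => ⨆ j, A i j) (Set.finite_range _).bddAbove i)

theorem mpPow_diag_le {n : ℕ} (A : Fin n → Fin n → ℝ) {p : ℕ} (hp : 1 ≤ p) (hpn : p ≤ n)
    (i : Fin n) : mpPow A p i i ≤ p * mpRho A := by
  obtain ⟨q, rfl⟩ := Nat.exists_eq_add_of_le' hp
  have h₁ : mpPow A (q + 1) i i ≤ mpTr (mpPow A (q + 1)) :=
    le_ciSup (f := fun i => mpPow A (q + 1) i i) (Set.finite_range _).bddAbove i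
  have h₂ : ((q : ℝ) + 1)⁻¹ * mpTr (mpPow A (q + 1)) ≤ mpRho A :=
    le_ciSup (f := fun p : Fin n => (((p : ℕ) + 1 : ℝ))⁻¹ * mpTr (mpPow A ((p : ℕ) + 1)))
      (Set.finite_range _).bddAbove ⟨q, hpn⟩
  rw [inv_mul_le_iff₀ (by positivity)] at h₂
  push_cast
  exact h₁.trans h₂

theorem exists_mpPow_diag_eq {n : ℕ} [Nonempty (Fin n)] (A : Fin n → Fin n → ℝ) :
    ∃ p : ℕ, 1 ≤ p ∧ ∃ i, mpPow A p i i = p * mpRho A := by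
  obtain ⟨q, hq⟩ := exists_eq_ciSup_of_finite
    (f := fun p : Fin n => (((p : ℕ) + 1 : ℝ))⁻¹ * mpTr (mpPow A ((p : ℕ) + 1)))
  obtain ⟨i, hi⟩ := exists_eq_ciSup_of_finite (f := fun i => mpPow A ((q : ℕ) + 1) i i)
  refine ⟨q + 1, by lia, i, hi.trans ?_⟩
  change mpTr (mpPow A ((q : ℕ) + 1)) = _
  rw [mpRho, ← hq]
  push_cast
  field_simp

/-- Total weight of the first `k` steps of the walk `w`. -/
def walkWeight {n : ℕ} (A : Fin n → Fin n → ℝ) (w : ℕ → Fin n) (k : ℕ) : ℝ :=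
  ∑ t ∈ Finset.range k, A (w t) (w (t + 1))

theorem walkWeight_add {n : ℕ} (A : Fin n → Fin n → ℝ) (w : ℕ → Fin n) (a b : ℕ) :
    walkWeight A w (a + b) = walkWeight A w a + walkWeight A (fun t => w (a + t)) b :=
  Finset.sum_range_add _ _ _

theorem walkWeight_succ {n : ℕ} (A : Fin n → Fin n → ℝ) (w : ℕ → Fin n) (k : ℕ) :
    walkWeight A w (k + 1) = walkWeight A w k + A (w k) (w (k + 1)) :=
  Finset.sum_range_succ _ _

theorem walkWeight_congr {n : ℕ} (A : Fin n → Fin n → ℝ) {v w : ℕ → Fin n} {k : ℕ}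
    (h : ∀ t ≤ k, v t = w t) : walkWeight A v k = walkWeight A w k := by
  refine Finset.sum_congr rfl fun t ht => ?_
  have := Finset.mem_range.1 ht
  rw [h t (by lia), h (t + 1) (by lia)]

theorem walkWeight_le_mpPow {n : ℕ} (A : Fin n → Fin n → ℝ) (w : ℕ → Fin n) {k : ℕ}
    (hk : 1 ≤ k) : walkWeight A w k ≤ mpPow A k (w 0) (w k) := by
  induction k, hk using Nat.le_induction with
  | base => simp [walkWeight, mpPow_one]
  | succ k hk ih =>
    rw [walkWeight_succ, mpPow_succ A hk]
    linarith [add_le_mpMul (mpPow A k) A (w 0) (w k) (w (k + 1))]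

theorem exists_walkWeight_eq_mpPow {n : ℕ} [Nonempty (Fin n)] (A : Fin n → Fin n → ℝ) {k : ℕ}
    (hk : 1 ≤ k) (i j : Fin n) : ∃ w : ℕ → Fin n, w k = j ∧ walkWeight A w k = mpPow A k i j := by
  induction k, hk using Nat.le_induction generalizing j with
  | base => exact ⟨fun t => if t = 0 then i else j, by simp, by simp [walkWeight, mpPow_one]⟩
  | succ k hk ih =>
    obtain ⟨m, hm⟩ := exists_mpMul_eq (mpPow A k) A i j
    obtain ⟨w, hw, hweight⟩ := ih m
    refine ⟨Function.update w (k + 1) j, by simp, ?_⟩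
    have hcongr : ∀ t ≤ k, Function.update w (k + 1) j t = w t := fun t ht =>
      Function.update_of_ne (by lia) _ _
    rw [walkWeight_succ, walkWeight_congr A hcongr, hcongr k le_rfl, hw, Function.update_self,
      hweight, mpPow_succ A hk, hm]

/-- Cutting the closed subwalk between times `a` and `a + d` out of a walk. -/
theorem exists_walkWeight_eq_add {n : ℕ} (A : Fin n → Fin n → ℝ) (w : ℕ → Fin n) {a d : ℕ}
    (h : w (a + d) = w a) (c : ℕ) :
    ∃ v : ℕ → Fin n,
      walkWeight A w (a + d + c) = walkWeight A (fun t => w (a + t)) d + walkWeight A v (a + c) := by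
  let v : ℕ → Fin n := fun t => if t ≤ a then w t else w (t + d)
  have hv₁ : walkWeight A v a = walkWeight A w a :=
    walkWeight_congr A fun t ht => if_pos ht
  have hv₂ : walkWeight A (fun t => v (a + t)) c = walkWeight A (fun t => w (a + d + t)) c := by
    refine walkWeight_congr A fun t _ => ?_
    rcases Nat.eq_zero_or_pos t with rfl | ht
    · simp [v, h]
    · simp only [v]
      rw [if_neg (by lia), add_right_comm]
  refine ⟨v, ?_⟩
  rw [walkWeight_add, walkWeight_add, walkWeight_add A v, hv₁, hv₂]
  ring

theorem exists_closed_subwalk {n : ℕ} (w : ℕ → Fin n) :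
    ∃ a d : ℕ, 1 ≤ d ∧ a + d ≤ n ∧ w (a + d) = w a := by
  obtain ⟨x, y, hxy, h⟩ := Fintype.exists_ne_map_eq_of_card_lt
    (fun t : Fin (n + 1) => w t) (by simp)
  wlog hlt : x < y generalizing x y
  · exact this y x hxy.symm h.symm (lt_of_le_of_ne (not_lt.1 hlt) hxy.symm)
  have hlt' : (x : ℕ) < y := hlt
  refine ⟨x, y - x, by lia, by lia, ?_⟩
  rw [Nat.add_sub_cancel' hlt'.le]
  exact h.symm

theorem walkWeight_le {n : ℕ} (A : Fin n → Fin n → ℝ) (w : ℕ → Fin n) (k : ℕ) :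
    walkWeight A w k ≤ k * mpRho A + n * |mpNorm A - mpRho A| := by
  induction k using Nat.strong_induction_on generalizing w with
  | _ k ih =>
    rcases lt_or_ge k n with hk | hk
    · have h₁ : walkWeight A w k ≤ k * mpNorm A := by
        simpa [walkWeight] using Finset.sum_le_card_nsmul (Finset.range k) _ (mpNorm A)
          fun t _ => le_mpNorm A (w t) (w (t + 1))
      have h₂ : (k : ℝ) * (mpNorm A - mpRho A) ≤ n * |mpNorm A - mpRho A| := by
        refine (mul_le_mul_of_nonneg_left (le_abs_self _) k.cast_nonneg).trans ?_
        gcongr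
      linarith
    · obtain ⟨a, d, hd, hadn, h⟩ := exists_closed_subwalk w
      obtain ⟨c, rfl⟩ := Nat.exists_eq_add_of_le (hadn.trans hk)
      obtain ⟨v, hv⟩ := exists_walkWeight_eq_add A w h c
      have h₁ := walkWeight_le_mpPow A (fun t => w (a + t)) hd
      simp only [add_zero, h] at h₁
      have h₂ := mpPow_diag_le A hd (by lia) (w a)
      have h₃ := ih (a + c) (by lia) v
      push_cast at h₃ ⊢
      linarith

theorem mpNorm_mpPow_le {n : ℕ} [Nonempty (Fin n)] (A : Fin n → Fin n → ℝ) {k : ℕ}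
    (hk : 1 ≤ k) : mpNorm (mpPow A k) ≤ k * mpRho A + n * |mpNorm A - mpRho A| := by
  refine ciSup_le fun i => ciSup_le fun j => ?_
  obtain ⟨w, -, hw⟩ := exists_walkWeight_eq_mpPow A hk i j
  exact hw ▸ walkWeight_le A w k

theorem exists_le_mpNorm_mpPow {n : ℕ} [Nonempty (Fin n)] (A : Fin n → Fin n → ℝ) :
    ∃ C : ℝ, ∀ k : ℕ, 1 ≤ k → k * mpRho A - C ≤ mpNorm (mpPow A k) := by
  obtain ⟨p, hp, i, hi⟩ := exists_mpPow_diag_eq A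
  let f : ℕ → ℝ := fun k => |k * mpRho A - mpPow A k i i|
  refine ⟨∑ k ∈ Finset.range (p + 1), f k, fun k hk => le_trans ?_ (le_mpNorm _ i i)⟩
  induction k using Nat.strong_induction_on with
  | _ k ih =>
    rcases le_or_gt k p with hkp | hkp
    · have h₁ : f k ≤ ∑ k ∈ Finset.range (p + 1), f k :=
        Finset.single_le_sum (fun t _ => abs_nonneg _) (Finset.mem_range.2 (by lia))
      linarith [le_abs_self (k * mpRho A - mpPow A k i i)]
    · obtain ⟨m, rfl⟩ := Nat.exists_eq_add_of_le hkp.le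
      have h₁ := ih m (by lia) (by lia)
      have h₂ := mpPow_add_le A hp (by lia : 1 ≤ m) i i i
      push_cast
      linarith

/-- For every `n ≥ 1` and every real `n×n` matrix `A`, the limit
`lim_{k→∞} (1/k)·‖A^⊗k‖` exists and equals the max-plus spectral radius `ρ(A)`. -/
theorem stmt_1 {n : ℕ} (hn : 1 ≤ n) (A : Fin n → Fin n → ℝ) :
    Tendsto (fun k : ℕ => (k : ℝ)⁻¹ * mpNorm (mpPow A k)) atTop (nhds (mpRho A)) := by
  have : Nonempty (Fin n) := ⟨⟨0, hn⟩⟩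
  obtain ⟨C, hC⟩ := exists_le_mpNorm_mpPow A
  have hlim (c : ℝ) : Tendsto (fun k : ℕ => mpRho A + c * (k : ℝ)⁻¹) atTop (nhds (mpRho A)) := by
    simpa using (tendsto_inv_atTop_nhds_zero_nat (𝕜 := ℝ)).const_mul c |>.const_add (mpRho A)
  refine tendsto_of_tendsto_of_tendsto_of_le_of_le' (hlim (-C))
    (hlim (n * |mpNorm A - mpRho A|)) ?_ ?_
  · filter_upwards [eventually_ge_atTop 1] with k hk
    have hk' : (0 : ℝ) < k := by exact_mod_cast hk
    rw [le_inv_mul_iff₀ hk']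
    refine le_trans (le_of_eq ?_) (hC k hk)
    field_simp
    ring
  · filter_upwards [eventually_ge_atTop 1] with k hk
    have hk' : (0 : ℝ) < k := by exact_mod_cast hk
    rw [inv_mul_le_iff₀ hk']
    refine (mpNorm_mpPow_le A hk).trans (le_of_eq ?_)
    field_simp
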